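/- arXiv:2407.01830 — 2 statements merged into one kernel-verified Lean document; each statement's English description precedes it below -/
import Mathlib

section
/- Let ν ∈ ℕ, let ω ∈ ℝ^ν be non-resonant, and let b = ν − 1. For every ε > 0 there exists a constant K = K(ω, ε) > 0 such that for every T ∈ (0,1], every C ≥ 1, every a ∈ ℤ^ν, and every c : ℤ^ν → ℂ supported in {n ∈ ℤ^ν : |n − a| ≤ C}, one has limsup_{L→∞} (1/(2L)) ∫_0^T ∫_{−L}^{L} | ∑_{n ∈ ℤ^ν} c_n e^{i(⟨n⟩_ω x − t ⟨n⟩_ω²)} |^4 dx dt ≤ K^4 · T^{1/2} · C^{b + 4ε} · ( ∑_{n ∈ ℤ^ν} |c_n|² )². (L^4 Strichartz estimate for Schrödinger evolution with height localized to an arbitrary ball Q^a_C, Corollary 5.4 in its free-solution form.) -/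
open MeasureTheory Filter

/-- The frequency `⟨n⟩_ω = n · ω` of a lattice point `n ∈ ℤ^ν`. -/
noncomputable def freqQP {ν : ℕ} (ω : Fin ν → ℝ) (n : Fin ν → ℤ) : ℝ :=
  ∑ i, (n i : ℝ) * ω i

/-- The height `|n|` (Euclidean norm) of a lattice point `n ∈ ℤ^ν`. -/
noncomputable def heightQP {ν : ℕ} (n : Fin ν → ℤ) : ℝ :=
  Real.sqrt (∑ i, ((n i : ℝ)) ^ 2)

/-- Integral of a character over `[-L, L]`. -/
noncomputable def charInt (L θ : ℝ) : ℂ := ∫ x in Set.Icc (-L) L, Complex.exp (Complex.I * θ * x)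

lemma charInt_zero (L : ℝ) (hL : 0 < L) : charInt L 0 = 2 * L := by
  unfold charInt
  simp [Measure.real, Real.volume_Icc]
  rw [ENNReal.toReal_ofReal (by linarith)]
  push_cast; ring

lemma charInt_bound (L θ : ℝ) (hL : 0 < L) (hθ : θ ≠ 0) : ‖charInt L θ‖ ≤ 2 / |θ| := by
  unfold charInt
  rw [integral_Icc_eq_integral_Ioc, ← intervalIntegral.integral_of_le (by linarith)]
  have h : (Complex.I * θ : ℂ) ≠ 0 := by simp [hθ]
  rw [integral_exp_mul_complex h, norm_div]
  have e1 : ∀ y : ℝ, ‖Complex.exp (Complex.I * θ * y)‖ = 1 := by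
    intro y
    have : (Complex.I * θ * y : ℂ) = ((θ * y : ℝ) : ℂ) * Complex.I := by push_cast; ring
    rw [this, Complex.norm_exp_ofReal_mul_I]
  have e2 : ‖(Complex.I * θ : ℂ)‖ = |θ| := by simp
  rw [e2]
  gcongr
  refine (norm_sub_le _ _).trans ?_
  rw [e1, e1]; norm_num

lemma charInt_tendsto (θ : ℝ) :
    Tendsto (fun L : ℝ => ((1 / (2 * L) : ℝ) : ℂ) * charInt L θ) atTop
      (nhds (if θ = 0 then 1 else 0)) := by
  split_ifs with h
  · subst h
    refine tendsto_const_nhds.congr' ?_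
    filter_upwards [eventually_gt_atTop 0] with L hL
    rw [charInt_zero L hL]
    have : (L : ℂ) ≠ 0 := by exact_mod_cast hL.ne'
    push_cast; field_simp
  · have h0 : Tendsto (fun L : ℝ => (1 / |θ|) * L⁻¹) atTop (nhds 0) := by
      simpa using tendsto_inv_atTop_zero.const_mul (1 / |θ|)
    refine squeeze_zero_norm' ?_ h0
    filter_upwards [eventually_gt_atTop 0] with L hL
    rw [norm_mul, Complex.norm_real, Real.norm_of_nonneg (by positivity)]
    calc 1 / (2 * L) * ‖charInt L θ‖ ≤ 1 / (2 * L) * (2 / |θ|) := by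
          gcongr; exact charInt_bound L θ hL h
      _ = _ := by
          have : |θ| ≠ 0 := by simpa using h
          field_simp

section
variable {ι : Type*} (P : Finset ι) (A : ι → ℂ) (Λ Φ : ι → ℝ)

/-- Spatial integral of the square of a trigonometric polynomial. -/
noncomputable def innerInt (L t : ℝ) : ℝ :=
  ∫ x in Set.Icc (-L) L,
    ‖∑ p ∈ P, A p * Complex.exp (Complex.I * ((Λ p * x - t * Φ p : ℝ) : ℂ))‖ ^ 2

lemma innerInt_nonneg (L t : ℝ) : 0 ≤ innerInt P A Λ Φ L t := by
  unfold innerInt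
  exact integral_nonneg fun x => by positivity

lemma innerInt_eq (L t : ℝ) :
    (innerInt P A Λ Φ L t : ℂ) = ∑ p ∈ P, ∑ q ∈ P, A p * (starRingEnd ℂ) (A q) *
      charInt L (Λ p - Λ q) * Complex.exp (Complex.I * ((Φ q - Φ p : ℝ) : ℂ) * t) := by
  unfold innerInt
  rw [← integral_complex_ofReal]
  have key : ∀ x : ℝ,
      (((‖∑ p ∈ P, A p * Complex.exp (Complex.I * ((Λ p * x - t * Φ p : ℝ) : ℂ))‖ ^ 2 : ℝ)) : ℂ)
      = ∑ p ∈ P, ∑ q ∈ P, (A p * (starRingEnd ℂ) (A q) *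
        Complex.exp (Complex.I * ((Φ q - Φ p : ℝ) : ℂ) * t)) *
          Complex.exp (Complex.I * ((Λ p - Λ q : ℝ) : ℂ) * x) := by
    intro x
    push_cast
    rw [← Complex.mul_conj', map_sum, Finset.sum_mul_sum]
    refine Finset.sum_congr rfl fun p _ => Finset.sum_congr rfl fun q _ => ?_
    rw [map_mul, ← Complex.exp_conj]
    simp only [map_mul, map_sub, Complex.conj_I, Complex.conj_ofReal]
    rw [mul_mul_mul_comm, ← Complex.exp_add, mul_assoc (A p * _), ← Complex.exp_add]
    congr 2
    ring
  have hIntg : ∀ (z : ℂ) (θ : ℝ), Integrable (fun x : ℝ => z * Complex.exp (Complex.I * (θ:ℂ) * x))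
      (volume.restrict (Set.Icc (-L) L)) := by
    intro z θ
    exact ContinuousOn.integrableOn_compact isCompact_Icc (by fun_prop)
  rw [integral_congr_ae (Filter.Eventually.of_forall key)]
  rw [integral_finsetSum _ (fun p _ => integrable_finsetSum _ (fun q _ => hIntg _ _))]
  refine Finset.sum_congr rfl fun p _ => ?_
  rw [integral_finsetSum _ (fun q _ => hIntg _ _)]
  refine Finset.sum_congr rfl fun q _ => ?_
  rw [integral_const_mul]
  unfold charInt
  ring

lemma gauss_integrable (b θ : ℝ) (hb : 0 < b) (z : ℂ) :
    Integrable (fun t : ℝ => z * (Complex.exp (Complex.I * (θ : ℂ) * t) *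
      Complex.exp (-(b : ℂ) * t ^ 2))) := by
  refine Integrable.const_mul ?_ z
  refine (integrable_cexp_quadratic (b := (b : ℂ)) (by simpa using hb) (Complex.I * θ) 0).congr ?_
  refine Filter.Eventually.of_forall fun t => ?_
  simp only
  rw [← Complex.exp_add]
  congr 1; ring

lemma gauss_eq (T θ : ℝ) (hT : 0 < T) :
    ∫ t : ℝ, Complex.exp (Complex.I * (θ : ℂ) * t) * Complex.exp (-((1 / T ^ 2 : ℝ) : ℂ) * t ^ 2)
      = ((Real.sqrt Real.pi * T * Real.exp (-(T * θ) ^ 2 / 4) : ℝ) : ℂ) := by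
  have hb : 0 < (((1 / T ^ 2 : ℝ) : ℂ)).re := by rw [Complex.ofReal_re]; positivity
  rw [fourierIntegral_gaussian hb]
  have hT' : (T : ℂ) ≠ 0 := by exact_mod_cast hT.ne'
  have h1 : ((Real.pi : ℂ) / ((1 / T ^ 2 : ℝ) : ℂ)) ^ (1 / 2 : ℂ) =
      ((Real.sqrt Real.pi * T : ℝ) : ℂ) := by
    have : ((Real.pi : ℂ) / ((1 / T ^ 2 : ℝ) : ℂ)) = ((Real.pi * T ^ 2 : ℝ) : ℂ) := by
      push_cast; field_simp
    rw [this]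
    have h2 : (1 / 2 : ℂ) = ((1 / 2 : ℝ) : ℂ) := by push_cast; rfl
    rw [h2, ← Complex.ofReal_cpow (by positivity), ← Real.sqrt_eq_rpow,
      Real.sqrt_mul (by positivity), Real.sqrt_sq hT.le]
  rw [h1]
  push_cast
  congr 2
  field_simp

lemma gaussInt (L T : ℝ) (hT : 0 < T) :
    Integrable (fun t : ℝ => Real.exp (-(1 / T ^ 2) * t ^ 2) * innerInt P A Λ Φ L t) ∧
    ((∫ t : ℝ, Real.exp (-(1 / T ^ 2) * t ^ 2) * innerInt P A Λ Φ L t : ℝ) : ℂ) =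
     ∑ p ∈ P, ∑ q ∈ P, A p * (starRingEnd ℂ) (A q) * charInt L (Λ p - Λ q) *
      ((Real.sqrt Real.pi * T * Real.exp (-(T * (Φ q - Φ p)) ^ 2 / 4) : ℝ) : ℂ) := by
  have hb : 0 < 1 / T ^ 2 := by positivity
  have key : ∀ t : ℝ,
      ((Real.exp (-(1 / T ^ 2) * t ^ 2) * innerInt P A Λ Φ L t : ℝ) : ℂ) =
      ∑ p ∈ P, ∑ q ∈ P, (A p * (starRingEnd ℂ) (A q) * charInt L (Λ p - Λ q)) *
        (Complex.exp (Complex.I * ((Φ q - Φ p : ℝ) : ℂ) * t) *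
          Complex.exp (-((1 / T ^ 2 : ℝ) : ℂ) * t ^ 2)) := by
    intro t
    rw [Complex.ofReal_mul, innerInt_eq, Finset.mul_sum]
    refine Finset.sum_congr rfl fun p _ => ?_
    rw [Finset.mul_sum]
    refine Finset.sum_congr rfl fun q _ => ?_
    push_cast
    ring
  have hI : Integrable (fun t : ℝ =>
      ((Real.exp (-(1 / T ^ 2) * t ^ 2) * innerInt P A Λ Φ L t : ℝ) : ℂ)) := by
    refine Integrable.congr ?_ (Filter.Eventually.of_forall fun t => (key t).symm)
    exact integrable_finsetSum _ (fun p _ => integrable_finsetSum _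
      (fun q _ => gauss_integrable _ _ hb _))
  constructor
  · exact hI.re
  · rw [← integral_complex_ofReal]
    rw [integral_congr_ae (Filter.Eventually.of_forall key)]
    rw [integral_finsetSum _ (fun p _ => integrable_finsetSum _
      (fun q _ => gauss_integrable _ _ hb _))]
    refine Finset.sum_congr rfl fun p _ => ?_
    rw [integral_finsetSum _ (fun q _ => gauss_integrable _ _ hb _)]
    refine Finset.sum_congr rfl fun q _ => ?_
    rw [integral_const_mul, gauss_eq T _ hT]

lemma schur_bound (T W : ℝ) (hT : 0 < T)
    (hW : ∀ p ∈ P, ∑ q ∈ P with Λ q = Λ p, Real.exp (-(T * (Φ q - Φ p)) ^ 2 / 4) ≤ W) :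
    (∑ p ∈ P, ∑ q ∈ P, A p * (starRingEnd ℂ) (A q) * (if Λ p - Λ q = 0 then 1 else 0) *
      ((Real.sqrt Real.pi * T * Real.exp (-(T * (Φ q - Φ p)) ^ 2 / 4) : ℝ) : ℂ)).re
    ≤ Real.sqrt Real.pi * T * W * ∑ p ∈ P, ‖A p‖ ^ 2 := by
  set w : ι → ι → ℝ := fun p q =>
    if Λ q = Λ p then Real.exp (-(T * (Φ q - Φ p)) ^ 2 / 4) else 0 with hw
  have hwsymm : ∀ p q, w p q = w q p := by
    intro p q
    simp only [hw, eq_comm (a := Λ q)]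
    split_ifs
    · congr 1; ring
    · rfl
  have hw0 : ∀ p q, 0 ≤ w p q := by
    intro p q; simp only [hw]; split_ifs <;> positivity
  have hW' : ∀ p ∈ P, ∑ q ∈ P, w p q ≤ W := by
    intro p hp
    rw [← Finset.sum_filter]; exact hW p hp
  have hc : 0 ≤ Real.sqrt Real.pi * T := by positivity
  calc _ ≤ ‖∑ p ∈ P, ∑ q ∈ P, A p * (starRingEnd ℂ) (A q) * (if Λ p - Λ q = 0 then 1 else 0) *
      ((Real.sqrt Real.pi * T * Real.exp (-(T * (Φ q - Φ p)) ^ 2 / 4) : ℝ) : ℂ)‖ :=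
        Complex.re_le_norm _
    _ ≤ ∑ p ∈ P, ∑ q ∈ P, Real.sqrt Real.pi * T *
          (‖A p‖ ^ 2 * w p q / 2 + ‖A q‖ ^ 2 * w p q / 2) := by
        refine (norm_sum_le _ _).trans (Finset.sum_le_sum fun p _ => ?_)
        refine (norm_sum_le _ _).trans (Finset.sum_le_sum fun q _ => ?_)
        have : ‖A p * (starRingEnd ℂ) (A q) * (if Λ p - Λ q = 0 then 1 else 0) *
          ((Real.sqrt Real.pi * T * Real.exp (-(T * (Φ q - Φ p)) ^ 2 / 4) : ℝ) : ℂ)‖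
          = Real.sqrt Real.pi * T * (‖A p‖ * ‖A q‖ * w p q) := by
          rw [norm_mul, norm_mul, norm_mul, Complex.norm_real, RCLike.norm_conj,
            Real.norm_of_nonneg (by positivity)]
          simp only [hw, sub_eq_zero, eq_comm (a := Λ q)]
          split_ifs
          · simp; ring
          · simp
        rw [this]
        refine mul_le_mul_of_nonneg_left ?_ hc
        nlinarith [mul_nonneg (hw0 p q) (sq_nonneg (‖A p‖ - ‖A q‖))]
    _ = Real.sqrt Real.pi * T * ∑ p ∈ P, ‖A p‖ ^ 2 * ∑ q ∈ P, w p q := by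
        simp_rw [← Finset.mul_sum, Finset.sum_add_distrib]
        congr 1
        rw [Finset.sum_comm (f := fun p q => ‖A q‖ ^ 2 * w p q / 2), ← Finset.sum_add_distrib]
        refine Finset.sum_congr rfl fun p _ => ?_
        rw [← Finset.sum_add_distrib, Finset.mul_sum]
        refine Finset.sum_congr rfl fun q _ => ?_
        rw [hwsymm q p]; ring
    _ ≤ Real.sqrt Real.pi * T * ∑ p ∈ P, ‖A p‖ ^ 2 * W := by
        refine mul_le_mul_of_nonneg_left (Finset.sum_le_sum fun p hp => ?_) hc
        exact mul_le_mul_of_nonneg_left (hW' p hp) (by positivity)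
    _ = _ := by rw [← Finset.sum_mul]; ring

lemma limsup_bound (T W : ℝ) (hT : 0 < T)
    (hW : ∀ p ∈ P, ∑ q ∈ P with Λ q = Λ p, Real.exp (-(T * (Φ q - Φ p)) ^ 2 / 4) ≤ W) :
    limsup (fun L : ℝ => (1 / (2 * L)) * ∫ t in Set.Icc (0 : ℝ) T, innerInt P A Λ Φ L t) atTop
    ≤ Real.exp 1 * (Real.sqrt Real.pi * T * W * ∑ p ∈ P, ‖A p‖ ^ 2) := by
  set G : ℝ → ℝ := fun L => Real.exp 1 * ((1 / (2 * L)) *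
    ∫ t : ℝ, Real.exp (-(1 / T ^ 2) * t ^ 2) * innerInt P A Λ Φ L t) with hG
  set Z : ℂ := ∑ p ∈ P, ∑ q ∈ P, A p * (starRingEnd ℂ) (A q) * (if Λ p - Λ q = 0 then 1 else 0) *
      ((Real.sqrt Real.pi * T * Real.exp (-(T * (Φ q - Φ p)) ^ 2 / 4) : ℝ) : ℂ) with hZ
  have hlimC : Tendsto (fun L : ℝ => (((1 / (2 * L)) *
      ∫ t : ℝ, Real.exp (-(1 / T ^ 2) * t ^ 2) * innerInt P A Λ Φ L t : ℝ) : ℂ)) atTop (nhds Z) := by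
    have : (fun L : ℝ => (((1 / (2 * L)) *
      ∫ t : ℝ, Real.exp (-(1 / T ^ 2) * t ^ 2) * innerInt P A Λ Φ L t : ℝ) : ℂ)) = fun L =>
      ∑ p ∈ P, ∑ q ∈ P, A p * (starRingEnd ℂ) (A q) *
        (((1 / (2 * L) : ℝ) : ℂ) * charInt L (Λ p - Λ q)) *
      ((Real.sqrt Real.pi * T * Real.exp (-(T * (Φ q - Φ p)) ^ 2 / 4) : ℝ) : ℂ) := by
      funext L
      rw [Complex.ofReal_mul, (gaussInt P A Λ Φ L T hT).2, Finset.mul_sum]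
      refine Finset.sum_congr rfl fun p _ => ?_
      rw [Finset.mul_sum]
      refine Finset.sum_congr rfl fun q _ => ?_
      ring
    rw [this]
    refine tendsto_finsetSum _ fun p _ => tendsto_finsetSum _ fun q _ => ?_
    exact ((charInt_tendsto _).const_mul _).mul_const _
  have hlim : Tendsto G atTop (nhds (Real.exp 1 * Z.re)) := by
    refine Tendsto.const_mul _ ?_
    have := (Complex.continuous_re.tendsto Z).comp hlimC
    simpa [Function.comp_def] using this
  have hle : (fun L : ℝ => (1 / (2 * L)) * ∫ t in Set.Icc (0 : ℝ) T, innerInt P A Λ Φ L t)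
      ≤ᶠ[atTop] G := by
    filter_upwards [eventually_gt_atTop 0] with L hL
    simp only [hG]
    rw [mul_left_comm]
    refine mul_le_mul_of_nonneg_left ?_ (by positivity)
    rw [← integral_const_mul]
    have hIntg := (gaussInt P A Λ Φ L T hT).1.const_mul (Real.exp 1)
    have hnn : ∀ t, 0 ≤ Real.exp 1 * (Real.exp (-(1 / T ^ 2) * t ^ 2) * innerInt P A Λ Φ L t) :=
      fun t => mul_nonneg (by positivity) (mul_nonneg (by positivity) (innerInt_nonneg _ _ _ _ _ _))
    refine le_trans ?_ (setIntegral_le_integral (s := Set.Icc 0 T) hIntg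
      (Filter.Eventually.of_forall hnn))
    refine integral_mono_of_nonneg (Filter.Eventually.of_forall (innerInt_nonneg P A Λ Φ L))
      hIntg.integrableOn ?_
    refine (ae_restrict_iff' measurableSet_Icc).2 (Filter.Eventually.of_forall fun t ht => ?_)
    have h1 : 1 ≤ Real.exp 1 * Real.exp (-(1 / T ^ 2) * t ^ 2) := by
      rw [← Real.exp_add]
      refine Real.one_le_exp ?_
      have : t ^ 2 / T ^ 2 ≤ 1 := by
        rw [div_le_one (by positivity)]
        exact pow_le_pow_left₀ ht.1 ht.2 2
      have h2 : -(1 / T ^ 2) * t ^ 2 = -(t ^ 2 / T ^ 2) := by ring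
      rw [h2]; linarith
    simp only
    rw [← mul_assoc]
    exact le_mul_of_one_le_left (innerInt_nonneg _ _ _ _ _ _) h1
  have h1 := limsup_le_limsup hle (IsBoundedUnder.isCoboundedUnder_le ⟨0, by
      rw [eventually_map]
      filter_upwards [eventually_gt_atTop 0] with L hL
      exact mul_nonneg (by positivity) (integral_nonneg fun t => innerInt_nonneg _ _ _ _ _ _)⟩)
      hlim.isBoundedUnder_le
  rw [hlim.limsup_eq] at h1
  refine h1.trans (mul_le_mul_of_nonneg_left ?_ (by positivity))
  exact schur_bound P A Λ Φ T W hT hW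
end

lemma summ_int : Summable fun m : ℤ => 1 / (1 + (m : ℝ) ^ 2) := by
  have h := (Real.summable_one_div_int_add_rpow (1/2) 2).2 (by norm_num)
  refine Summable.of_nonneg_of_le (fun m => by positivity) (fun m => ?_) (h.mul_left 4)
  have h2 : |(m : ℝ) + 1 / 2| ^ (2 : ℝ) = ((m : ℝ) + 1 / 2) ^ 2 := by
    rw [Real.rpow_two, sq_abs]
  have h3 : 0 < ((m : ℝ) + 1 / 2) ^ 2 := by
    have : (2 * (m:ℝ) + 1) ≠ 0 := by
      have : (2 * m + 1 : ℤ) ≠ 0 := by omega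
      exact_mod_cast this
    have h4 : ((m : ℝ) + 1 / 2) ≠ 0 := fun h => this (by linarith)
    positivity
  rw [h2, mul_one_div, div_le_div_iff₀ (by positivity) h3]
  nlinarith [sq_nonneg (m - 1 : ℝ)]

lemma gauss_sum_bound : ∃ Z : ℝ, 0 < Z ∧ ∀ {ι : Type} (Q : Finset ι) (s : ι → ℝ) (N : ℝ),
    0 ≤ N → (∀ m : ℤ, ((Q.filter fun q => ⌊s q⌋ = m).card : ℝ) ≤ N) →
    ∑ q ∈ Q, Real.exp (-(s q) ^ 2 / 4) ≤ N * Z := by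
  refine ⟨8 * ∑' m : ℤ, 1 / (1 + (m : ℝ) ^ 2), ?_, ?_⟩
  · have := summ_int.le_tsum (0 : ℤ) (fun m _ => by positivity)
    have h0 : (0:ℝ) < 1 / (1 + ((0:ℤ):ℝ) ^ 2) := by positivity
    linarith
  intro ι Q s N hN h
  classical
  have hpt : ∀ y : ℝ, Real.exp (-y ^ 2 / 4) ≤ 8 * (1 / (1 + (⌊y⌋ : ℝ) ^ 2)) := by
    intro y
    have h1 : Real.exp (-y ^ 2 / 4) ≤ 1 / (1 + y ^ 2 / 4) := by
      have : -y ^ 2 / 4 = -(y ^ 2 / 4) := by ring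
      rw [this, Real.exp_neg, ← one_div]
      refine one_div_le_one_div_of_le (by positivity) ?_
      linarith [Real.add_one_le_exp (y ^ 2 / 4)]
    refine h1.trans ?_
    rw [mul_one_div, div_le_div_iff₀ (by positivity) (by positivity)]
    have h2 := Int.floor_le y
    have h3 := Int.lt_floor_add_one y
    nlinarith [sq_nonneg (y + 1), sq_nonneg (y - 1), sq_nonneg ((⌊y⌋:ℝ) - 2 * y)]
  rw [← Finset.sum_fiberwise_of_maps_to (t := Q.image fun q => ⌊s q⌋) (g := fun q => ⌊s q⌋)
    (fun q hq => Finset.mem_image_of_mem _ hq)]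
  calc _ ≤ ∑ m ∈ Q.image fun q => ⌊s q⌋, N * (8 * (1 / (1 + (m : ℝ) ^ 2))) := by
        refine Finset.sum_le_sum fun m _ => ?_
        calc _ ≤ ∑ q ∈ Q with ⌊s q⌋ = m, 8 * (1 / (1 + (m : ℝ) ^ 2)) := by
              refine Finset.sum_le_sum fun q hq => ?_
              rw [← (Finset.mem_filter.1 hq).2]; exact hpt _
          _ ≤ _ := by
              rw [Finset.sum_const, nsmul_eq_mul]
              exact mul_le_mul_of_nonneg_right (h m) (by positivity)
    _ ≤ _ := by
        rw [← Finset.mul_sum, ← Finset.mul_sum]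
        gcongr
        exact summ_int.sum_le_tsum _ (fun m _ => by positivity)

lemma int_card_bound (Q : Finset ℤ) (D : ℝ) (hD : 0 ≤ D)
    (h : ∀ x ∈ Q, ∀ y ∈ Q, (y : ℝ) - x ≤ D) : (Q.card : ℝ) ≤ 1 + D := by
  rcases Q.eq_empty_or_nonempty with rfl | hQ
  · simp; linarith
  have hsub : Q ⊆ Finset.Icc (Q.min' hQ) (Q.max' hQ) := fun x hx =>
    Finset.mem_Icc.2 ⟨Q.min'_le x hx, Q.le_max' x hx⟩
  have h1 := Finset.card_le_card hsub
  rw [Int.card_Icc] at h1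
  have h2 := h _ (Q.min'_mem hQ) _ (Q.max'_mem hQ)
  have h3 : Q.min' hQ ≤ Q.max' hQ := Q.min'_le _ (Q.max'_mem hQ)
  have h4 : (Q.card : ℤ) ≤ Q.max' hQ + 1 - Q.min' hQ := by omega
  have h5 : (Q.card : ℝ) ≤ Q.max' hQ + 1 - Q.min' hQ := by exact_mod_cast h4
  linarith

/-- Box counting with one coordinate constrained, up to a sign. -/
lemma box_count (b : ℕ) (C D : ℝ) (hC : 1 ≤ C) (hD : 0 ≤ D) (a : Fin (b + 1) → ℤ)
    (Q : Finset (Fin (b + 1) → ℤ)) (sg : (Fin (b + 1) → ℤ) → Bool)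
    (hQ : ∀ n ∈ Q, ∀ i, |((n i - a i : ℤ) : ℝ)| ≤ C)
    (h : ∀ n ∈ Q, ∀ m ∈ Q, sg n = sg m → Fin.tail n = Fin.tail m → (m 0 : ℝ) - n 0 ≤ D) :
    (Q.card : ℝ) ≤ 2 * (3 * C) ^ b * (1 + D) := by
  classical
  let B : Finset (Fin b → ℤ) := Fintype.piFinset fun i => Finset.Icc (a i.succ - ⌊C⌋) (a i.succ + ⌊C⌋)
  have hfl : (1 : ℤ) ≤ ⌊C⌋ := by rw [Int.le_floor]; exact_mod_cast hC
  have hB : (B.card : ℝ) ≤ (3 * C) ^ b := by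
    simp only [B, Fintype.card_piFinset, Int.card_Icc, Nat.cast_prod]
    calc _ ≤ ∏ i : Fin b, (3 * C) := by
          refine Finset.prod_le_prod (fun i _ => by positivity) fun i _ => ?_
          have e : ((a i.succ + ⌊C⌋ + 1 - (a i.succ - ⌊C⌋)).toNat : ℤ) = 2 * ⌊C⌋ + 1 := by omega
          have e' : ((a i.succ + ⌊C⌋ + 1 - (a i.succ - ⌊C⌋)).toNat : ℝ) = 2 * ⌊C⌋ + 1 := by
            exact_mod_cast e
          rw [e']
          have := Int.floor_le C
          linarith
      _ = _ := by simp
  have hmaps : ∀ n ∈ Q, (sg n, Fin.tail n) ∈ (Finset.univ : Finset Bool) ×ˢ B := by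
    intro n hn
    refine Finset.mem_product.2 ⟨Finset.mem_univ _, ?_⟩
    simp only [B, Fintype.mem_piFinset, Finset.mem_Icc, Fin.tail]
    intro i
    have h1 := abs_le.1 (hQ n hn i.succ)
    have h2 : n i.succ - a i.succ ≤ ⌊C⌋ := Int.le_floor.2 h1.2
    have h3 : -(n i.succ - a i.succ) ≤ ⌊C⌋ := Int.le_floor.2 (by push_cast at h1 ⊢; linarith [h1.1])
    constructor <;> linarith
  have hfib : ∀ v ∈ (Finset.univ : Finset Bool) ×ˢ B,
      ((Q.filter fun n => (sg n, Fin.tail n) = v).card : ℝ) ≤ 1 + D := by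
    intro v _
    have hinj : Set.InjOn (fun n : Fin (b+1) → ℤ => n 0)
        (Q.filter fun n => (sg n, Fin.tail n) = v) := by
      intro n hn m hm hnm
      simp only [Finset.coe_filter, Set.mem_ofPred_eq] at hn hm
      have : Fin.tail n = Fin.tail m := by
        rw [← hm.2] at hn; exact (Prod.ext_iff.1 hn.2).2
      rw [← Fin.cons_self_tail n, ← Fin.cons_self_tail m, this]
      simp only at hnm
      rw [hnm]
    rw [← Finset.card_image_of_injOn hinj]
    refine int_card_bound _ D hD ?_
    intro x hx y hy
    obtain ⟨n, hn, rfl⟩ := Finset.mem_image.1 hx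
    obtain ⟨m, hm, rfl⟩ := Finset.mem_image.1 hy
    obtain ⟨hn, hn'⟩ := Finset.mem_filter.1 hn
    obtain ⟨hm, hm'⟩ := Finset.mem_filter.1 hm
    rw [← hm'] at hn'
    exact h n hn m hm (Prod.ext_iff.1 hn').1 (Prod.ext_iff.1 hn').2
  rw [Finset.card_eq_sum_card_fiberwise (f := fun n => (sg n, Fin.tail n)) hmaps, Nat.cast_sum]
  refine (Finset.sum_le_sum hfib).trans ?_
  rw [Finset.sum_const, nsmul_eq_mul, Finset.card_product]
  simp only [Finset.card_univ, Fintype.card_bool, Nat.cast_mul, Nat.cast_ofNat]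
  gcongr

lemma freqQP_add {ν : ℕ} (ω : Fin ν → ℝ) (n m : Fin ν → ℤ) :
    freqQP ω (n + m) = freqQP ω n + freqQP ω m := by
  simp [freqQP, add_mul, Finset.sum_add_distrib]

lemma freqQP_sub {ν : ℕ} (ω : Fin ν → ℝ) (n m : Fin ν → ℤ) :
    freqQP ω (n - m) = freqQP ω n - freqQP ω m := by
  simp [freqQP, sub_mul, Finset.sum_sub_distrib]

lemma freqQP_tail {b : ℕ} (ω : Fin (b + 1) → ℝ) (n m : Fin (b + 1) → ℤ)
    (h : Fin.tail n = Fin.tail m) :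
    freqQP ω m - freqQP ω n = ((m 0 : ℝ) - n 0) * ω 0 := by
  have : ∀ i : Fin b, n i.succ = m i.succ := fun i => congrFun h i
  simp only [freqQP, Fin.sum_univ_succ, this]
  ring

lemma abs_le_heightQP {ν : ℕ} (n : Fin ν → ℤ) (i : Fin ν) : |(n i : ℝ)| ≤ heightQP n := by
  unfold heightQP
  rw [← Real.sqrt_sq_eq_abs]
  refine Real.sqrt_le_sqrt ?_
  exact Finset.single_le_sum (f := fun i => ((n i : ℝ)) ^ 2) (fun _ _ => by positivity)
    (Finset.mem_univ i)

lemma same_sign_sq (u v h : ℝ) (hs : 0 ≤ u * v) (huv : |v ^ 2 - u ^ 2| ≤ h) :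
    (v - u) ^ 2 ≤ h := by
  obtain ⟨h1, h2⟩ := abs_le.1 huv
  rcases le_total (u ^ 2) (v ^ 2) with h3 | h3
  · have : u ^ 2 ≤ u * v := by
      have := sq_le_sq.1 h3
      calc u ^ 2 = |u| * |u| := by rw [← sq, sq_abs]
        _ ≤ |u| * |v| := by gcongr
        _ = u * v := by rw [← abs_mul, abs_of_nonneg hs]
    nlinarith
  · have : v ^ 2 ≤ u * v := by
      have := sq_le_sq.1 h3
      calc v ^ 2 = |v| * |v| := by rw [← sq, sq_abs]
        _ ≤ |u| * |v| := by gcongr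
        _ = u * v := by rw [← abs_mul, abs_of_nonneg hs]
    nlinarith

/-- Number of pairs with prescribed sum and nearly prescribed phase. -/
lemma pair_count (b : ℕ) (ω : Fin (b + 1) → ℝ) (hpos : 0 < ω 0) (C T y : ℝ) (hC : 1 ≤ C)
    (hT : 0 < T) (hT1 : T ≤ 1) (a k : Fin (b + 1) → ℤ)
    (R : Finset ((Fin (b + 1) → ℤ) × (Fin (b + 1) → ℤ)))
    (hR : ∀ q ∈ R, q.1 + q.2 = k) (hRa : ∀ q ∈ R, ∀ i, |((q.1 i - a i : ℤ) : ℝ)| ≤ C)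
    (j : ℤ)
    (hj : ∀ q ∈ R, ⌊T * (freqQP ω q.1 ^ 2 + freqQP ω q.2 ^ 2 - y)⌋ = j) :
    (R.card : ℝ) ≤ 2 * 3 ^ b * (1 + 1 / ω 0) * (C ^ b * (Real.sqrt T)⁻¹) := by
  classical
  have hsT : 0 < Real.sqrt T := Real.sqrt_pos.2 hT
  have hsT1 : Real.sqrt T ≤ 1 := Real.sqrt_le_one.2 hT1
  have hinj : Set.InjOn (fun q : (Fin (b + 1) → ℤ) × (Fin (b + 1) → ℤ) => q.1) R := by
    intro q hq r hr h
    have h1 := hR q hq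
    have h2 := hR r hr
    simp only at h
    refine Prod.ext h ?_
    rw [h, ← h2] at h1
    exact add_left_cancel h1
  have key : (((R.image fun q => q.1)).card : ℝ) ≤
      2 * (3 * C) ^ b * (1 + 1 / (ω 0 * Real.sqrt T)) := by
    refine box_count b C _ hC (by positivity) a _
      (fun n => decide (0 ≤ 2 * freqQP ω n - freqQP ω k)) ?_ ?_
    · intro n hn
      obtain ⟨q, hq, rfl⟩ := Finset.mem_image.1 hn
      exact hRa q hq
    · intro n hn m hm hs ht
      obtain ⟨q, hq, rfl⟩ := Finset.mem_image.1 hn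
      obtain ⟨r, hr, rfl⟩ := Finset.mem_image.1 hm
      have hq2 : freqQP ω q.2 = freqQP ω k - freqQP ω q.1 := by
        rw [← hR q hq, freqQP_add]; ring
      have hr2 : freqQP ω r.2 = freqQP ω k - freqQP ω r.1 := by
        rw [← hR r hr, freqQP_add]; ring
      have hd := freqQP_tail ω _ _ ht
      have h1 := Int.abs_sub_lt_one_of_floor_eq_floor ((hj r hr).trans (hj q hq).symm)
      have e : T * (freqQP ω r.1 ^ 2 + freqQP ω r.2 ^ 2 - y) -
          T * (freqQP ω q.1 ^ 2 + freqQP ω q.2 ^ 2 - y) = (T / 2) *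
          ((2 * freqQP ω r.1 - freqQP ω k) ^ 2 - (2 * freqQP ω q.1 - freqQP ω k) ^ 2) := by
        rw [hq2, hr2]; ring
      rw [e, abs_mul, abs_of_pos (by positivity)] at h1
      have h2 : |(2 * freqQP ω r.1 - freqQP ω k) ^ 2 - (2 * freqQP ω q.1 - freqQP ω k) ^ 2|
          ≤ 2 / T := by
        rw [le_div_iff₀ hT]; linarith
      have hsign : 0 ≤ (2 * freqQP ω q.1 - freqQP ω k) * (2 * freqQP ω r.1 - freqQP ω k) := by
        rw [decide_eq_decide] at hs
        by_cases h0 : 0 ≤ 2 * freqQP ω q.1 - freqQP ω k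
        · exact mul_nonneg h0 (hs.1 h0)
        · have h0' : ¬ (0 ≤ 2 * freqQP ω r.1 - freqQP ω k) := fun h => h0 (hs.2 h)
          push Not at h0 h0'
          exact (mul_pos_of_neg_of_neg h0 h0').le
      have h3 := same_sign_sq _ _ _ hsign h2
      have e2 : (2 * freqQP ω r.1 - freqQP ω k) - (2 * freqQP ω q.1 - freqQP ω k) =
          2 * (((r.1 0 : ℝ) - q.1 0) * ω 0) := by rw [← hd]; ring
      rw [e2, le_div_iff₀ hT] at h3
      rw [le_div_iff₀ (by positivity)]
      refine (abs_le_one_iff_mul_self_le_one.2 ?_ |> fun h => (le_abs_self _).trans h)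
      have e3 : Real.sqrt T * Real.sqrt T = T := Real.mul_self_sqrt hT.le
      have e4 : ((r.1 0 : ℝ) - q.1 0) * (ω 0 * Real.sqrt T) *
        (((r.1 0 : ℝ) - q.1 0) * (ω 0 * Real.sqrt T)) =
         (((r.1 0 : ℝ) - q.1 0) * ω 0) ^ 2 * (Real.sqrt T * Real.sqrt T) := by ring
      rw [e4, e3]
      nlinarith
  rw [Finset.card_image_of_injOn hinj] at key
  refine key.trans ?_
  have h5 : 1 + 1 / (ω 0 * Real.sqrt T) ≤ (1 + 1 / ω 0) * (Real.sqrt T)⁻¹ := by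
    have : 1 ≤ (Real.sqrt T)⁻¹ := (one_le_inv₀ hsT).2 hsT1
    have e5 : (1 + 1 / ω 0) * (Real.sqrt T)⁻¹ = (Real.sqrt T)⁻¹ + 1 / (ω 0 * Real.sqrt T) := by
      field_simp
    rw [e5]; linarith
  calc _ ≤ 2 * (3 * C) ^ b * ((1 + 1 / ω 0) * (Real.sqrt T)⁻¹) := by gcongr
    _ = _ := by rw [mul_pow]; ring





/-- `L⁴` Strichartz estimate for the Schrödinger evolution with height localized to an
arbitrary ball `Q^a_C` (Corollary 5.4 in its free-solution form). -/
theorem L4_strichartz_schrodinger_ball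
    (ν : ℕ) (hν : 1 ≤ ν) (ω : Fin ν → ℝ)
    (hpos : ∀ i, 0 < ω i)
    (hnr : ∀ n : Fin ν → ℤ, freqQP ω n = 0 → n = 0)
    (ε : ℝ) (hε : 0 < ε) :
    ∃ K : ℝ, 0 < K ∧ ∀ T : ℝ, T ∈ Set.Ioc (0 : ℝ) 1 →
      ∀ C : ℝ, 1 ≤ C → ∀ a : Fin ν → ℤ,
      ∀ c : (Fin ν → ℤ) → ℂ, (∀ n, c n ≠ 0 → heightQP (n - a) ≤ C) →
      limsup (fun L : ℝ =>
          (1 / (2 * L)) * ∫ t in Set.Icc (0 : ℝ) T, ∫ x in Set.Icc (-L) L,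
            ‖∑' n : Fin ν → ℤ, c n *
              Complex.exp (Complex.I *
                ((freqQP ω n * x - t * freqQP ω n ^ 2 : ℝ) : ℂ))‖ ^ 4) atTop
        ≤ K ^ 4 * T ^ ((1 : ℝ) / 2) * C ^ (((ν : ℝ) - 1) + 4 * ε) *
            (∑' n : Fin ν → ℤ, ‖c n‖ ^ 2) ^ 2 := by
  classical
  obtain ⟨b, rfl⟩ : ∃ b, ν = b + 1 := ⟨ν - 1, by omega⟩
  obtain ⟨Z, hZ, hZs⟩ := gauss_sum_bound
  have hω := hpos 0
  set K0 : ℝ := Real.exp 1 * Real.sqrt Real.pi * Z * (2 * 3 ^ b * (1 + 1 / ω 0)) with hK0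
  have hK0pos : 0 < K0 := by positivity
  refine ⟨K0 ^ ((1 : ℝ) / 4), by positivity, ?_⟩
  intro T hT C hC a c hc
  have hK4 : (K0 ^ ((1 : ℝ) / 4)) ^ 4 = K0 := by
    rw [← Real.rpow_natCast, ← Real.rpow_mul hK0pos.le]; norm_num
  rw [hK4]
  obtain ⟨hT0, hT1⟩ := hT
  let S : Finset (Fin (b + 1) → ℤ) :=
    Fintype.piFinset fun i => Finset.Icc (a i - ⌊C⌋) (a i + ⌊C⌋)
  have hS : ∀ n ∈ S, ∀ i, |((n i - a i : ℤ) : ℝ)| ≤ C := by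
    intro n hn i
    have h := Finset.mem_Icc.1 (Fintype.mem_piFinset.1 hn i)
    have h1 : |n i - a i| ≤ ⌊C⌋ := abs_le.2 ⟨by linarith, by linarith⟩
    have h2 := Int.le_floor.1 h1
    rwa [Int.cast_abs] at h2
  have hcS : ∀ n, n ∉ S → c n = 0 := by
    intro n hn
    by_contra h
    refine hn (Fintype.mem_piFinset.2 fun i => Finset.mem_Icc.2 ?_)
    have h1 := (abs_le_heightQP (n - a) i).trans (hc n h)
    rw [Pi.sub_apply, ← Int.cast_abs] at h1
    have h2 := abs_le.1 (Int.le_floor.2 h1)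
    constructor <;> linarith [h2.1, h2.2]
  let A : (Fin (b + 1) → ℤ) × (Fin (b + 1) → ℤ) → ℂ := fun p => c p.1 * c p.2
  let Λ : (Fin (b + 1) → ℤ) × (Fin (b + 1) → ℤ) → ℝ := fun p => freqQP ω p.1 + freqQP ω p.2
  let Φ : (Fin (b + 1) → ℤ) × (Fin (b + 1) → ℤ) → ℝ :=
    fun p => freqQP ω p.1 ^ 2 + freqQP ω p.2 ^ 2
  have hfun : (fun L : ℝ =>
          (1 / (2 * L)) * ∫ t in Set.Icc (0 : ℝ) T, ∫ x in Set.Icc (-L) L,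
            ‖∑' n : Fin (b + 1) → ℤ, c n *
              Complex.exp (Complex.I *
                ((freqQP ω n * x - t * freqQP ω n ^ 2 : ℝ) : ℂ))‖ ^ 4) =
      fun L : ℝ => (1 / (2 * L)) * ∫ t in Set.Icc (0 : ℝ) T, innerInt (S ×ˢ S) A Λ Φ L t := by
    funext L
    congr 2
    funext t
    unfold innerInt
    congr 1
    funext x
    rw [tsum_eq_sum (s := S) (fun n hn => by rw [hcS n hn, zero_mul])]
    rw [show (4 : ℕ) = 2 * 2 from rfl, pow_mul, ← norm_pow, sq (∑ n ∈ S, _), Finset.sum_mul_sum,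
      ← Finset.sum_product']
    congr 2
    refine Finset.sum_congr rfl fun p _ => ?_
    simp only [A, Λ, Φ]
    rw [mul_mul_mul_comm, ← Complex.exp_add]
    congr 2
    push_cast
    ring
  rw [hfun]
  set N : ℝ := 2 * 3 ^ b * (1 + 1 / ω 0) * (C ^ b * (Real.sqrt T)⁻¹) with hN
  have hmain := limsup_bound (S ×ˢ S) A Λ Φ T (N * Z) hT0 (by
    intro p hp
    refine hZs _ (fun q => T * (Φ q - Φ p)) N (by positivity) ?_
    intro j
    refine pair_count b ω hω C T (Φ p) hC hT0 hT1 a (p.1 + p.2) _ ?_ ?_ j ?_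
    · intro q hq
      have h1 : Λ q = Λ p := (Finset.mem_filter.1 (Finset.mem_filter.1 hq).1).2
      have h2 : freqQP ω ((q.1 + q.2) - (p.1 + p.2)) = 0 := by
        rw [freqQP_sub, freqQP_add, freqQP_add]
        exact sub_eq_zero.2 h1
      exact sub_eq_zero.1 (hnr _ h2)
    · intro q hq
      exact hS _ (Finset.mem_product.1 (Finset.mem_filter.1 (Finset.mem_filter.1 hq).1).1).1
    · intro q hq
      exact (Finset.mem_filter.1 hq).2)
  refine hmain.trans ?_
  have hsum : ∑ p ∈ S ×ˢ S, ‖A p‖ ^ 2 = (∑' n, ‖c n‖ ^ 2) ^ 2 := by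
    rw [tsum_eq_sum (s := S) (fun n hn => by rw [hcS n hn]; simp), sq (∑ n ∈ S, _),
      Finset.sum_mul_sum, ← Finset.sum_product']
    refine Finset.sum_congr rfl fun p _ => ?_
    simp only [A, norm_mul, mul_pow]
  rw [hsum]
  have hCb : C ^ b ≤ C ^ ((((b + 1 : ℕ) : ℝ) - 1) + 4 * ε) := by
    rw [← Real.rpow_natCast]
    refine Real.rpow_le_rpow_of_exponent_le hC ?_
    push_cast; linarith
  have hTT : T * (Real.sqrt T)⁻¹ = T ^ ((1 : ℝ) / 2) := by
    rw [← Real.sqrt_eq_rpow, ← div_eq_mul_inv, Real.div_sqrt]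
  calc _ = K0 * (T * (Real.sqrt T)⁻¹) * C ^ b * (∑' n, ‖c n‖ ^ 2) ^ 2 := by
        rw [hK0, hN]; ring
    _ ≤ _ := by
        rw [hTT]
        gcongr
end

section
/- Let ν ≥ 2, let ω ∈ ℝ^ν be non-resonant with ω_i ∈ (1/2,1] for all i, let p ∈ {4, 6}, and let s < (ν−1)(1/2 − 1/p). Then there is NO constant K > 0 with the following property: for every C ≥ 1 and every a : ℤ^ν → ℂ supported in {n ∈ ℤ^ν : |n| ≤ C}, limsup_{L→∞} (1/(2L)) ∫_0^1 ∫_{−L}^{L} | ∑_{n ∈ ℤ^ν} a_n e^{i(⟨n⟩_ω x − t ⟨n⟩_ω²)} |^p dx dt ≤ K^p · C^{ps} · ( ∑_n |a_n|² )^{p/2}. (Sharpness of the fixed-time Strichartz estimates: the L^p([0,1]) Strichartz estimate with loss C^s fails for s < (ν−1)(1/2 − 1/p), Proposition 6.1.) -/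
open MeasureTheory Filter

lemma sss_cos_mean (lam θ : ℝ) :
    Tendsto (fun L : ℝ => (1 / (2 * L)) * ∫ t in Set.Icc (0 : ℝ) 1, ∫ x in Set.Icc (-L) L,
      Real.cos (lam * x - t * θ)) atTop
      (nhds (if lam = 0 then ∫ t in Set.Icc (0 : ℝ) 1, Real.cos (t * θ) else 0)) := by
  split_ifs with h
  · subst h
    refine Tendsto.congr' ?_ tendsto_const_nhds
    filter_upwards [eventually_gt_atTop 0] with L hL
    have : ∀ t : ℝ, ∫ x in Set.Icc (-L) L, Real.cos (0 * x - t * θ)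
        = (2 * L) * Real.cos (t * θ) := by
      intro t
      simp only [zero_mul, zero_sub, Real.cos_neg, setIntegral_const, smul_eq_mul]
      congr 1
      rw [Real.volume_real_Icc_of_le (by linarith)]
      ring
    simp only [this]
    rw [integral_const_mul, ← mul_assoc, one_div_mul_cancel (by positivity), one_mul]
  · have hb : ∀ᶠ L : ℝ in atTop, ‖(1 / (2 * L)) * ∫ t in Set.Icc (0 : ℝ) 1,
        ∫ x in Set.Icc (-L) L, Real.cos (lam * x - t * θ)‖ ≤ (1 / |lam|) * L⁻¹ := by
      filter_upwards [eventually_gt_atTop 0] with L hL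
      have h1 : ∀ t : ℝ, ‖∫ x in Set.Icc (-L) L, Real.cos (lam * x - t * θ)‖ ≤ 2 / |lam| := by
        intro t
        rw [integral_Icc_eq_integral_Ioc, ← intervalIntegral.integral_of_le (by linarith),
          intervalIntegral.integral_comp_mul_sub (fun y => Real.cos y) h, integral_cos, norm_smul,
          norm_inv, Real.norm_eq_abs, Real.norm_eq_abs, inv_mul_eq_div]
        gcongr
        have a1 := Real.abs_sin_le_one (lam * L - t * θ)
        have a2 := Real.abs_sin_le_one (lam * -L - t * θ)
        rw [abs_le] at *
        constructor <;> linarith [a1.1, a1.2, a2.1, a2.2]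
      have h2 := norm_setIntegral_le_of_norm_le_const (μ := volume) (s := Set.Icc (0 : ℝ) 1)
        (f := fun t => ∫ x in Set.Icc (-L) L, Real.cos (lam * x - t * θ)) (C := 2 / |lam|)
        (by simp) (fun t _ => h1 t)
      rw [Real.volume_real_Icc_of_le (by norm_num)] at h2
      rw [norm_mul, Real.norm_of_nonneg (by positivity)]
      calc _ ≤ (1 / (2 * L)) * (2 / |lam| * (1 - 0)) := by gcongr
        _ = _ := by field_simp; ring
    refine squeeze_zero_norm' hb ?_
    simpa using tendsto_inv_atTop_zero.const_mul (1 / |lam|)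

lemma sss_half_le (θ : ℝ) (hθ : |θ| ≤ 1) :
    1 / 2 ≤ ∫ t in Set.Icc (0 : ℝ) 1, Real.cos (t * θ) := by
  have hc : Continuous fun t : ℝ => Real.cos (t * θ) := by fun_prop
  have h := setIntegral_mono_on (μ := volume) (s := Set.Icc (0 : ℝ) 1)
    (f := fun _ => (1 / 2 : ℝ)) (g := fun t => Real.cos (t * θ))
    (by simp) (hc.continuousOn.integrableOn_Icc) measurableSet_Icc ?_
  · simpa using h
  · intro t ht
    have h1 := Real.one_sub_sq_div_two_le_cos (x := t * θ)
    have h2 : |t * θ| ≤ 1 := by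
      rw [abs_mul, abs_of_nonneg ht.1]
      nlinarith [ht.2, abs_nonneg θ, ht.1]
    have h3 : (t * θ) ^ 2 ≤ 1 := by rwa [sq_le_one_iff_abs_le_one]
    show (1 / 2 : ℝ) ≤ Real.cos (t * θ)
    linarith

lemma sss_sum_mean {ι : Type*} (S : Finset ι) (lam θ : ι → ℝ) (hθ : ∀ j, |θ j| ≤ 1) :
    ∃ v : ℝ, Tendsto (fun L : ℝ => (1 / (2 * L)) * ∫ t in Set.Icc (0 : ℝ) 1,
      ∫ x in Set.Icc (-L) L, ∑ j ∈ S, Real.cos (lam j * x - t * θ j)) atTop (nhds v) ∧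
      (1 / 2 : ℝ) * (S.filter (fun j => lam j = 0)).card ≤ v := by
  refine ⟨∑ j ∈ S, (if lam j = 0 then ∫ t in Set.Icc (0 : ℝ) 1, Real.cos (t * θ j) else 0),
    ?_, ?_⟩
  · have h := tendsto_finsetSum S (fun j _ => sss_cos_mean (lam j) (θ j))
    refine h.congr fun L => ?_
    rw [← Finset.mul_sum]
    congr 1
    rw [← integral_finsetSum]
    · congr 1
      ext t
      rw [← integral_finsetSum]
      intro j _
      exact Continuous.integrableOn_Icc (by fun_prop)
    · intro j _
      refine Continuous.integrableOn_Icc ?_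
      refine continuous_parametric_integral_of_continuous ?_ isCompact_Icc
      fun_prop
  · rw [Finset.card_filter, Nat.cast_sum, Finset.mul_sum]
    refine Finset.sum_le_sum fun j _ => ?_
    split_ifs
    · simpa using sss_half_le _ (hθ j)
    · simp

lemma sss_norm_pow {ι : Type*} [Fintype ι] (k : ℕ) (φ : ι → ℝ) :
    ‖∑ q, Complex.exp (Complex.I * (φ q : ℂ))‖ ^ (2 * k) =
      ∑ P : (Fin k → ι) × (Fin k → ι), Real.cos (∑ i, φ (P.1 i) - ∑ i, φ (P.2 i)) := by
  set z := ∑ q, Complex.exp (Complex.I * (φ q : ℂ)) with hz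
  have h1 : ((‖z‖ ^ (2 * k) : ℝ) : ℂ) = z ^ k * ((starRingEnd ℂ) z) ^ k := by
    rw [← mul_pow, Complex.mul_conj, Complex.normSq_eq_norm_sq, pow_mul]
    push_cast
    rfl
  have h2 : (starRingEnd ℂ) z = ∑ q, Complex.exp (-(Complex.I * (φ q : ℂ))) := by
    rw [hz, map_sum]
    refine Finset.sum_congr rfl fun q _ => ?_
    rw [← Complex.exp_conj]
    simp
  rw [h2, hz, Fintype.sum_pow, Fintype.sum_pow, Fintype.sum_mul_sum, ← Fintype.sum_prod_type'] at h1
  have h3 := congrArg Complex.re h1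
  rw [Complex.ofReal_re, Complex.re_sum] at h3
  rw [h3]
  refine Finset.sum_congr rfl fun P _ => ?_
  rw [← Complex.exp_sum, ← Complex.exp_sum, ← Complex.exp_add, ← Complex.exp_ofReal_mul_I_re]
  congr 2
  push_cast
  rw [Finset.sum_neg_distrib, ← Finset.mul_sum, ← Finset.mul_sum]
  ring

lemma sss_energy {α β : Type*} [Fintype α] [DecidableEq β] (S : α → β) (T : Finset β)
    (hT : ∀ a, S a ∈ T) :
    (Fintype.card α) ^ 2 ≤ T.card *
      ((Finset.univ : Finset (α × α)).filter (fun P => S P.1 = S P.2)).card := by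
  classical
  have h1 : Fintype.card α = ∑ b ∈ T, (Finset.univ.filter (fun a => S a = b)).card :=
    Finset.card_eq_sum_card_fiberwise (fun a _ => hT a)
  have h2 : ((Finset.univ : Finset (α × α)).filter (fun P => S P.1 = S P.2)).card
      = ∑ b ∈ T, (Finset.univ.filter (fun a => S a = b)).card ^ 2 := by
    rw [Finset.card_eq_sum_card_fiberwise (f := fun P : α × α => S P.1) (t := T)
      (fun a _ => hT a.1)]
    refine Finset.sum_congr rfl fun b _ => ?_
    rw [sq, ← Finset.card_product]
    congr 1
    ext P
    simp only [Finset.mem_filter, Finset.mem_univ, true_and, Finset.mem_product]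
    constructor
    · rintro ⟨h, rfl⟩
      exact ⟨rfl, h.symm⟩
    · rintro ⟨h, h'⟩
      exact ⟨h.trans h'.symm, h⟩
  rw [h1, h2]
  exact sq_sum_le_card_mul_sum_sq

/-- Linear part of the frequency. -/
noncomputable def sssY {d : ℕ} (ω : Fin (d + 1) → ℝ) (q : Fin d → ℕ) : ℝ :=
  ∑ j, (q j : ℝ) * ω j.succ

/-- The lattice point near the hyperplane over `q`. -/
noncomputable def sssN {d : ℕ} (ω : Fin (d + 1) → ℝ) (q : Fin d → ℕ) : Fin (d + 1) → ℤ :=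
  Fin.cons (-round (sssY ω q / ω 0)) (fun j => (q j : ℤ))

lemma sss_freq {d : ℕ} (ω : Fin (d + 1) → ℝ) (q : Fin d → ℕ) :
    freqQP ω (sssN ω q) = sssY ω q - ω 0 * round (sssY ω q / ω 0) := by
  simp only [freqQP, sssN, Fin.sum_univ_succ, Fin.cons_zero, Fin.cons_succ, sssY]
  push_cast
  ring

lemma sss_freq_le {d : ℕ} (ω : Fin (d + 1) → ℝ) (h0 : ω 0 ∈ Set.Ioc (1 / 2 : ℝ) 1)
    (q : Fin d → ℕ) : |freqQP ω (sssN ω q)| ≤ 1 / 2 := by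
  have hpos : 0 < ω 0 := by linarith [h0.1]
  have h1 := abs_sub_round (sssY ω q / ω 0)
  have h2 : freqQP ω (sssN ω q) = ω 0 * (sssY ω q / ω 0 - round (sssY ω q / ω 0)) := by
    rw [sss_freq]
    field_simp
  rw [h2, abs_mul, abs_of_pos hpos]
  nlinarith [h0.2, abs_nonneg (sssY ω q / ω 0 - round (sssY ω q / ω 0))]

lemma sss_inj {d : ℕ} (ω : Fin (d + 1) → ℝ) : Function.Injective (sssN ω) := by
  intro q q' h
  ext j
  have := congrFun h j.succ
  simpa [sssN] using this

lemma sss_height {d : ℕ} (hd : 1 ≤ d) (ω : Fin (d + 1) → ℝ)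
    (hω : ∀ i, ω i ∈ Set.Ioc (1 / 2 : ℝ) 1) (R : ℕ) (q : Fin d → ℕ)
    (hq : ∀ j, q j < R) : heightQP (sssN ω q) ≤ 4 * d * R := by
  have hd' : (1 : ℝ) ≤ d := by exact_mod_cast hd
  have hR : (1 : ℝ) ≤ R := by
    have := hq ⟨0, hd⟩
    exact_mod_cast (by omega : 1 ≤ R)
  have h0 := hω 0
  have hpos : 0 < ω 0 := by linarith [h0.1]
  have hdR : (1 : ℝ) ≤ d * R := by nlinarith
  have hY0 : 0 ≤ sssY ω q := Finset.sum_nonneg fun j _ =>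
    mul_nonneg (by positivity) (by linarith [(hω j.succ).1])
  have hY : sssY ω q ≤ d * R := by
    calc sssY ω q ≤ ∑ j : Fin d, (R : ℝ) := by
          refine Finset.sum_le_sum fun j _ => ?_
          have h1 : (q j : ℝ) ≤ R := by exact_mod_cast (hq j).le
          have h2 := hω j.succ
          nlinarith [h2.1, h2.2, Nat.cast_nonneg (α := ℝ) (q j)]
      _ = d * R := by simp
  have hZ : |sssY ω q / ω 0| ≤ 2 * (d * R) := by
    rw [abs_of_nonneg (by positivity), div_le_iff₀ hpos]
    nlinarith [h0.1]
  have hr : |((round (sssY ω q / ω 0) : ℤ) : ℝ)| ≤ 3 * (d * R) := by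
    have h1 := abs_sub_round (sssY ω q / ω 0)
    rw [abs_le] at *
    constructor <;> linarith [h1.1, h1.2, hZ.1, hZ.2]
  have hr2 : ((round (sssY ω q / ω 0) : ℤ) : ℝ) ^ 2 ≤ (3 * (d * R)) ^ 2 := by
    rw [← sq_abs]
    gcongr
  have hs : ∑ j : Fin d, (q j : ℝ) ^ 2 ≤ d * R ^ 2 := by
    calc ∑ j : Fin d, (q j : ℝ) ^ 2 ≤ ∑ j : Fin d, (R : ℝ) ^ 2 := by
          refine Finset.sum_le_sum fun j _ => ?_
          have h1 : (q j : ℝ) ≤ R := by exact_mod_cast (hq j).le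
          gcongr
      _ = d * R ^ 2 := by simp
  rw [heightQP]
  refine Real.sqrt_le_iff.2 ⟨by positivity, ?_⟩
  simp only [sssN, Fin.sum_univ_succ, Fin.cons_zero, Fin.cons_succ]
  push_cast
  have : (d : ℝ) * R ^ 2 ≤ (d * R) ^ 2 := by
    rw [mul_pow]
    gcongr
    nlinarith
  nlinarith

lemma sss_count {d : ℕ} (ω : Fin (d + 1) → ℝ)
    (h0 : ω 0 ∈ Set.Ioc (1 / 2 : ℝ) 1) (R k : ℕ) (hk1 : 1 ≤ k) (hk : k ≤ 3) :
    ((R ^ d) ^ k) ^ 2 ≤ ((k * R) ^ d * 5) *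
      ((Finset.univ : Finset ((Fin k → Fin d → Fin R) × (Fin k → Fin d → Fin R))).filter
        (fun P => ∑ i, freqQP ω (sssN ω (fun j => (P.1 i j : ℕ)))
          - ∑ i, freqQP ω (sssN ω (fun j => (P.2 i j : ℕ))) = 0)).card := by
  have hpos : 0 < ω 0 := by linarith [h0.1]
  let Z : (Fin k → Fin d → Fin R) → Fin k → ℝ := fun F i => sssY ω (fun j => (F i j : ℕ))
  let S : (Fin k → Fin d → Fin R) → (Fin d → ℕ) × ℤ := fun F =>
    (fun j => ∑ i, (F i j : ℕ), ∑ i, -round (Z F i / ω 0) + round (∑ i, Z F i / ω 0))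
  let T : Finset ((Fin d → ℕ) × ℤ) :=
    (Fintype.piFinset fun _ : Fin d => Finset.range (k * R)) ×ˢ Finset.Icc (-2 : ℤ) 2
  have hT : ∀ F, S F ∈ T := by
    intro F
    simp only [S, T, Finset.mem_product, Fintype.mem_piFinset, Finset.mem_range, Finset.mem_Icc]
    refine ⟨fun j => ?_, ?_⟩
    · have : Nonempty (Fin k) := ⟨⟨0, hk1⟩⟩
      calc ∑ i, (F i j : ℕ) < ∑ i : Fin k, R :=
            Finset.sum_lt_sum_of_nonempty Finset.univ_nonempty fun i _ => (F i j).2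
        _ = k * R := by simp
    · have h1 : |∑ i, (Z F i / ω 0 - round (Z F i / ω 0))| ≤ 3 / 2 := by
        calc _ ≤ ∑ i, |Z F i / ω 0 - round (Z F i / ω 0)| := Finset.abs_sum_le_sum_abs _ _
          _ ≤ ∑ i : Fin k, (1 / 2 : ℝ) := Finset.sum_le_sum fun i _ => abs_sub_round _
          _ = k * (1 / 2) := by simp
          _ ≤ 3 / 2 := by
            have : (k : ℝ) ≤ 3 := by exact_mod_cast hk
            linarith
      have h2 := abs_sub_round (∑ i, Z F i / ω 0)
      rw [Finset.sum_sub_distrib] at h1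
      rw [abs_le] at h1 h2
      rw [Finset.sum_neg_distrib]
      constructor
      · have : ((-2 : ℤ) : ℝ) ≤ ((-∑ i, round (Z F i / ω 0) + round (∑ i, Z F i / ω 0) : ℤ) : ℝ) := by
          push_cast
          linarith [h1.1, h2.2]
        exact_mod_cast this
      · have : ((-∑ i, round (Z F i / ω 0) + round (∑ i, Z F i / ω 0) : ℤ) : ℝ) ≤ ((2 : ℤ) : ℝ) := by
          push_cast
          linarith [h1.2, h2.1]
        exact_mod_cast this
  have hE := sss_energy S T hT
  have hc : Fintype.card (Fin k → Fin d → Fin R) = (R ^ d) ^ k := by simp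
  have hTc : T.card = (k * R) ^ d * 5 := by
    simp [T, Finset.card_product]
  rw [hc, hTc] at hE
  refine hE.trans (Nat.mul_le_mul_left _ (Finset.card_le_card ?_))
  rintro ⟨F, G⟩
  simp only [Finset.mem_filter, Finset.mem_univ, true_and]
  intro h
  have hsum : ∀ F : Fin k → Fin d → Fin R, ∑ i, Z F i
      = ∑ j, ((∑ i, (F i j : ℕ) : ℕ) : ℝ) * ω j.succ := by
    intro F
    simp only [Z, sssY]
    rw [Finset.sum_comm]
    refine Finset.sum_congr rfl fun j _ => ?_
    rw [Nat.cast_sum, Finset.sum_mul]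
  have e1 := congrArg Prod.fst h
  have e2 := congrArg Prod.snd h
  simp only [S] at e1 e2
  have e3 : ∑ i, Z F i = ∑ i, Z G i := by
    rw [hsum, hsum]
    refine Finset.sum_congr rfl fun j _ => ?_
    rw [congrFun e1 j]
  have e4 : ∑ i, Z F i / ω 0 = ∑ i, Z G i / ω 0 := by
    rw [← Finset.sum_div, ← Finset.sum_div, e3]
  rw [e4, add_left_inj, Finset.sum_neg_distrib, Finset.sum_neg_distrib, neg_inj] at e2
  have e5 : (∑ i, (round (Z F i / ω 0) : ℝ)) = ∑ i, (round (Z G i / ω 0) : ℝ) := by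
    exact_mod_cast e2
  simp only [sss_freq, Finset.sum_sub_distrib, ← Finset.mul_sum]
  simp only [Z] at e3 e5
  rw [e3, e5]
  ring

lemma sss_theta {d : ℕ} (ω : Fin (d + 1) → ℝ) (h0 : ω 0 ∈ Set.Ioc (1 / 2 : ℝ) 1)
    (k : ℕ) (hk : k ≤ 3) (F G : Fin k → Fin d → ℕ) :
    |∑ i, freqQP ω (sssN ω (F i)) ^ 2 - ∑ i, freqQP ω (sssN ω (G i)) ^ 2| ≤ 1 := by
  have key : ∀ F : Fin k → Fin d → ℕ, 0 ≤ ∑ i, freqQP ω (sssN ω (F i)) ^ 2 ∧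
      ∑ i, freqQP ω (sssN ω (F i)) ^ 2 ≤ 1 := by
    intro F
    refine ⟨Finset.sum_nonneg fun i _ => sq_nonneg _, ?_⟩
    calc _ ≤ ∑ i : Fin k, (1 / 4 : ℝ) := by
          refine Finset.sum_le_sum fun i _ => ?_
          have := sss_freq_le ω h0 (F i)
          rw [← sq_abs]
          nlinarith [abs_nonneg (freqQP ω (sssN ω (F i)))]
      _ = k * (1 / 4) := by simp
      _ ≤ 1 := by
        have : (k : ℝ) ≤ 3 := by exact_mod_cast hk
        linarith
  rw [abs_le]
  constructor <;> linarith [(key F).1, (key F).2, (key G).1, (key G).2]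

lemma sss_main_ineq {d : ℕ} (hd : 1 ≤ d) (ω : Fin (d + 1) → ℝ)
    (hω : ∀ i, ω i ∈ Set.Ioc (1 / 2 : ℝ) 1) (k : ℕ) (hk1 : 1 ≤ k) (hk : k ≤ 3) (s K : ℝ)
    (H : ∀ C : ℝ, 1 ≤ C →
      ∀ a : (Fin (d + 1) → ℤ) → ℂ, (∀ n, a n ≠ 0 → heightQP n ≤ C) →
      limsup (fun L : ℝ =>
          (1 / (2 * L)) * ∫ t in Set.Icc (0 : ℝ) 1, ∫ x in Set.Icc (-L) L,
            ‖∑' n : Fin (d + 1) → ℤ, a n *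
              Complex.exp (Complex.I *
                ((freqQP ω n * x - t * freqQP ω n ^ 2 : ℝ) : ℂ))‖ ^ (2 * k)) atTop
        ≤ K * C ^ s * (∑' n : Fin (d + 1) → ℤ, ‖a n‖ ^ 2) ^ k)
    (R : ℕ) (hR : 1 ≤ R) :
    (((R : ℝ) ^ d) ^ k) ^ 2 ≤ (((k * R) ^ d * 5) * 2) * (K * (4 * d * R) ^ s * ((R : ℝ) ^ d) ^ k) := by
  classical
  let N : (Fin d → Fin R) → (Fin (d + 1) → ℤ) := fun q => sssN ω (fun j => (q j : ℕ))
  have hN : Function.Injective N := by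
    intro q q' h
    have := sss_inj ω h
    ext j
    exact congrFun this j
  let A : Finset (Fin (d + 1) → ℤ) := Finset.univ.image N
  have hsumA : ∀ {M : Type} [AddCommMonoid M] (g : (Fin (d + 1) → ℤ) → M),
      ∑ n ∈ A, g n = ∑ q, g (N q) := by
    intro M _ g
    exact Finset.sum_image (fun x _ y _ h => hN h)
  let a : (Fin (d + 1) → ℤ) → ℂ := fun n => if n ∈ A then 1 else 0
  have hd' : (1 : ℝ) ≤ d := by exact_mod_cast hd
  have hR' : (1 : ℝ) ≤ R := by exact_mod_cast hR
  have h1 := H (4 * d * R) (by nlinarith) a (by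
    intro n hn
    have hn' : n ∈ A := by
      by_contra hc
      exact hn (by simp [a, hc])
    obtain ⟨q, -, rfl⟩ := Finset.mem_image.1 hn'
    exact sss_height hd ω hω R _ (fun j => (q j).2))
  have ha2 : ∑' n, ‖a n‖ ^ 2 = (R : ℝ) ^ d := by
    rw [tsum_eq_sum (s := A) (fun n hn => by simp [a, hn]), hsumA]
    have : ∀ q, a (N q) = 1 := fun q => by simp [a, A]
    simp [this]
  have hu : ∀ t x : ℝ, ‖∑' n : Fin (d + 1) → ℤ, a n *
              Complex.exp (Complex.I *
                ((freqQP ω n * x - t * freqQP ω n ^ 2 : ℝ) : ℂ))‖ ^ (2 * k)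
      = ∑ P : (Fin k → Fin d → Fin R) × (Fin k → Fin d → Fin R),
        Real.cos ((∑ i, freqQP ω (N (P.1 i)) - ∑ i, freqQP ω (N (P.2 i))) * x
          - t * (∑ i, freqQP ω (N (P.1 i)) ^ 2 - ∑ i, freqQP ω (N (P.2 i)) ^ 2)) := by
    intro t x
    rw [tsum_eq_sum (s := A) (fun n hn => by simp [a, hn]), hsumA]
    have : ∀ q, a (N q) = 1 := fun q => by simp [a, A]
    simp only [this, one_mul]
    rw [sss_norm_pow k (fun q => freqQP ω (N q) * x - t * freqQP ω (N q) ^ 2)]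
    refine Finset.sum_congr rfl fun P _ => ?_
    congr 1
    simp only [Finset.sum_sub_distrib, ← Finset.sum_mul, ← Finset.mul_sum]
    ring
  simp only [hu] at h1
  obtain ⟨v, hv, hv2⟩ := sss_sum_mean
    (Finset.univ : Finset ((Fin k → Fin d → Fin R) × (Fin k → Fin d → Fin R)))
    (fun P => ∑ i, freqQP ω (N (P.1 i)) - ∑ i, freqQP ω (N (P.2 i)))
    (fun P => ∑ i, freqQP ω (N (P.1 i)) ^ 2 - ∑ i, freqQP ω (N (P.2 i)) ^ 2)
    (fun P => sss_theta ω (hω 0) k hk _ _)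
  rw [hv.limsup_eq, ha2] at h1
  have hc := sss_count ω (hω 0) R k hk1 hk
  have hc' : (((R : ℝ) ^ d) ^ k) ^ 2 ≤ (((k : ℝ) * R) ^ d * 5) *
      ((Finset.univ : Finset ((Fin k → Fin d → Fin R) × (Fin k → Fin d → Fin R))).filter
        (fun P => ∑ i, freqQP ω (N (P.1 i)) - ∑ i, freqQP ω (N (P.2 i)) = 0)).card := by
    exact_mod_cast hc
  refine hc'.trans ?_
  rw [mul_assoc (((k : ℝ) * R) ^ d * 5)]
  gcongr
  linarith

lemma sss_contra {d : ℕ} (hd : 1 ≤ d) (k : ℕ) (s K : ℝ)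
    (hs : s < d * ((k : ℝ) - 1))
    (H : ∀ R : ℕ, 1 ≤ R → (((R : ℝ) ^ d) ^ k) ^ 2 ≤
      (((k * R) ^ d * 5) * 2) * (K * (4 * d * R) ^ s * ((R : ℝ) ^ d) ^ k)) : False := by
  set M : ℝ := (k : ℝ) ^ d * 10 * K * (4 * d) ^ s with hM
  have hδ : 0 < d * ((k : ℝ) - 1) - s := by linarith
  have ht := (tendsto_rpow_atTop hδ).comp (tendsto_natCast_atTop_atTop (R := ℝ))
  obtain ⟨R, hR1, hR2⟩ := ((ht.eventually_gt_atTop M).and (eventually_ge_atTop 1)).exists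
  have hRp : (0 : ℝ) < R := by exact_mod_cast hR2
  have h := H R hR2
  rw [Real.mul_rpow (by positivity) hRp.le] at h
  set Q : ℝ := ((R : ℝ) ^ d) ^ k with hQ
  have hQp : 0 < Q := by positivity
  have h2 : Q ≤ M * (R : ℝ) ^ d * (R : ℝ) ^ s := by
    refine le_of_mul_le_mul_right ?_ hQp
    calc Q * Q = Q ^ 2 := by ring
      _ ≤ _ := h
      _ = _ := by rw [hM, mul_pow]; ring
  have h3 : Q = (R : ℝ) ^ (d * ((k : ℝ) - 1) - s) * (R : ℝ) ^ d * (R : ℝ) ^ s := by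
    rw [← Real.rpow_natCast (R : ℝ) d, ← Real.rpow_add hRp, ← Real.rpow_add hRp, hQ, ← pow_mul,
      ← Real.rpow_natCast]
    congr 1
    push_cast
    ring
  have h4 : M * (R : ℝ) ^ d * (R : ℝ) ^ s < Q := by
    rw [h3]
    have : M < (R : ℝ) ^ (d * ((k : ℝ) - 1) - s) := hR1
    gcongr
  linarith

/-- Sharpness of the fixed-time Strichartz estimates (Proposition 6.1): the
`L^p([0,1])` Strichartz estimate with loss `C^s` fails for
`s < (ν−1)(1/2 − 1/p)`, `p ∈ {4,6}`. -/
theorem strichartz_sharpness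
    (ν : ℕ) (hν : 2 ≤ ν) (ω : Fin ν → ℝ)
    (hω : ∀ i, ω i ∈ Set.Ioc (1 / 2 : ℝ) 1)
    (hnr : ∀ n : Fin ν → ℤ, freqQP ω n = 0 → n = 0)
    (p : ℝ) (hp : p = 4 ∨ p = 6)
    (s : ℝ) (hs : s < ((ν : ℝ) - 1) * (1 / 2 - 1 / p)) :
    ¬ ∃ K : ℝ, 0 < K ∧ ∀ C : ℝ, 1 ≤ C →
      ∀ a : (Fin ν → ℤ) → ℂ, (∀ n, a n ≠ 0 → heightQP n ≤ C) →
      limsup (fun L : ℝ =>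
          (1 / (2 * L)) * ∫ t in Set.Icc (0 : ℝ) 1, ∫ x in Set.Icc (-L) L,
            ‖∑' n : Fin ν → ℤ, a n *
              Complex.exp (Complex.I *
                ((freqQP ω n * x - t * freqQP ω n ^ 2 : ℝ) : ℂ))‖ ^ p) atTop
        ≤ K ^ p * C ^ (p * s) * (∑' n : Fin ν → ℤ, ‖a n‖ ^ 2) ^ (p / 2) := by
  rintro ⟨K, hK, H⟩
  obtain ⟨d, rfl⟩ : ∃ d, ν = d + 1 := ⟨ν - 1, by omega⟩
  have hd : 1 ≤ d := by omega
  obtain ⟨k, hk1, hk3, hpk⟩ : ∃ k : ℕ, 1 ≤ k ∧ k ≤ 3 ∧ p = ((2 * k : ℕ) : ℝ) := by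
    rcases hp with rfl | rfl
    · exact ⟨2, by norm_num, by norm_num, by norm_num⟩
    · exact ⟨3, by norm_num, by norm_num, by norm_num⟩
  have hp0 : 0 < p := by rcases hp with rfl | rfl <;> norm_num
  refine sss_contra hd k (p * s) (K ^ p) ?_
    (sss_main_ineq hd ω hω k hk1 hk3 (p * s) (K ^ p) ?_)
  · have h1 : p * s < p * (((d + 1 : ℕ) : ℝ) - 1) * (1 / 2 - 1 / p) := by
      rw [mul_assoc]
      exact mul_lt_mul_of_pos_left hs hp0
    have h2 : p * (((d + 1 : ℕ) : ℝ) - 1) * (1 / 2 - 1 / p) = d * (p / 2 - 1) := by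
      field_simp
      push_cast
      ring
    have h3 : p / 2 = k := by
      rw [hpk]
      push_cast
      ring
    rw [h2, h3] at h1
    exact h1
  · intro C hC a ha
    have h := H C hC a ha
    have h3 : p / 2 = k := by
      rw [hpk]
      push_cast
      ring
    rw [h3, Real.rpow_natCast _ k] at h
    refine le_trans (le_of_eq ?_) h
    congr 1
    ext L
    simp only [← Real.rpow_natCast _ (2 * k), ← hpk]
end
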